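/- arXiv:2605.26413 — 2 statements merged into one kernel-verified Lean document; each statement's English description precedes it below -/
import Mathlib

section
/- Let d ≥ 1, let g : ℝᵈ → ℝ be a probability density with respect to Lebesgue measure that is log-supermodular, i.e., g(u) g(u') ≤ g(u ⊓ u') g(u ⊔ u') for all u, u' ∈ ℝᵈ, and let π : ℝᵈ → ℝ be measurable with 0 ≤ π ≤ 1 and nondecreasing with respect to the coordinatewise partial order. Suppose c₁ := ∫ π g dλ satisfies 0 < c₁ < 1, and set c₀ := 1 − c₁. Define f₁ := π g / c₁ and f₀ := (1 − π) g / c₀. Then the measure with density f₁ stochastically dominates the measure with density f₀: for every bounded Borel-measurable coordinatewise-nondecreasing φ : ℝᵈ → ℝ, ∫ φ f₁ dλ ≥ ∫ φ f₀ dλ. -/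
open MeasureTheory

theorem aux_alg (a b c e : ENNReal) (hac : a ≤ c) (hbc : b ≤ c) (h : a * b ≤ c * e) :
    a + b ≤ c + e := by
  rcases eq_or_ne c ⊤ with rfl | hc
  · simp
  rcases eq_or_ne e ⊤ with rfl | he
  · simp
  have ha : a ≠ ⊤ := ne_top_of_le_ne_top hc hac
  have hb : b ≠ ⊤ := ne_top_of_le_ne_top hc hbc
  lift a to NNReal using ha
  lift b to NNReal using hb
  lift c to NNReal using hc
  lift e to NNReal using he
  norm_cast at *
  rcases eq_or_ne c 0 with rfl | hc0
  · have h1 : a = 0 := by simpa using hac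
    have h2 : b = 0 := by simpa using hbc
    simp [h1, h2]
  have hcp : (0 : ℝ) < c := by
    have := pos_iff_ne_zero.mpr hc0
    exact_mod_cast this
  have h' : (a : ℝ) * b ≤ c * e := by exact_mod_cast h
  have h1 : (a : ℝ) ≤ c := by exact_mod_cast hac
  have h2 : (b : ℝ) ≤ c := by exact_mod_cast hbc
  have : (a : ℝ) + b ≤ c + e := by
    refine le_of_mul_le_mul_left ?_ hcp
    nlinarith [mul_nonneg (sub_nonneg.2 h1) (sub_nonneg.2 h2)]
  exact_mod_cast this

theorem aux_pt (f₁ f₂ f₃ f₄ : ℝ → ENNReal)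
    (h : ∀ x y, f₁ x * f₂ y ≤ f₃ (x ⊓ y) * f₄ (x ⊔ y)) (x y : ℝ) :
    f₁ x * f₂ y + f₁ y * f₂ x ≤ f₃ x * f₄ y + f₃ y * f₄ x := by
  wlog hxy : x ≤ y generalizing x y
  · have := this y x (le_of_not_ge hxy)
    rw [add_comm, add_comm (f₃ x * f₄ y)]
    exact this
  have h1 := h x y
  have h2 := h y x
  have h3 := h x x
  have h4 := h y y
  simp only [inf_of_le_left hxy, sup_of_le_right hxy, inf_of_le_right hxy, sup_of_le_left hxy,
    inf_idem, sup_idem] at h1 h2 h3 h4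
  refine aux_alg _ _ _ _ h1 h2 ?_
  calc f₁ x * f₂ y * (f₁ y * f₂ x) = (f₁ x * f₂ x) * (f₁ y * f₂ y) := by ring
    _ ≤ (f₃ x * f₄ x) * (f₃ y * f₄ y) := mul_le_mul' h3 h4
    _ = _ := by ring

theorem aux_sym (f g : ℝ → ENNReal) (hf : Measurable f) (hg : Measurable g) :
    ∫⁻ x, ∫⁻ y, (f x * g y + f y * g x) = 2 * ((∫⁻ x, f x) * ∫⁻ x, g x) := by
  have : ∀ x, ∫⁻ y, (f x * g y + f y * g x) = f x * (∫⁻ y, g y) + (∫⁻ y, f y) * g x := by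
    intro x
    rw [lintegral_add_left (by fun_prop), lintegral_const_mul _ hg, lintegral_mul_const _ hf]
  simp_rw [this]
  rw [lintegral_add_left (by fun_prop), lintegral_const_mul _ hg, lintegral_mul_const _ hf]
  ring

theorem four_one (f₁ f₂ f₃ f₄ : ℝ → ENNReal)
    (m₁ : Measurable f₁) (m₂ : Measurable f₂) (m₃ : Measurable f₃) (m₄ : Measurable f₄)
    (h : ∀ x y, f₁ x * f₂ y ≤ f₃ (x ⊓ y) * f₄ (x ⊔ y)) :
    (∫⁻ x, f₁ x) * (∫⁻ x, f₂ x) ≤ (∫⁻ x, f₃ x) * ∫⁻ x, f₄ x := by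
  have := lintegral_mono (μ := volume) (fun x => lintegral_mono (μ := volume)
    (fun y => aux_pt f₁ f₂ f₃ f₄ h x y))
  rw [aux_sym _ _ m₁ m₂, aux_sym _ _ m₃ m₄] at this
  exact (ENNReal.mul_le_mul_iff_right (by simp) (by simp)).1 this

theorem pi_cons (n : ℕ) (t : ℝ) (x : Fin n → ℝ) :
    (MeasurableEquiv.piFinSuccAbove (fun _ : Fin (n+1) => ℝ) 0).symm (t, x) = Fin.cons t x := by
  simp [MeasurableEquiv.piFinSuccAbove, Fin.insertNthEquiv]

theorem lint_succ (n : ℕ) (f : (Fin (n+1) → ℝ) → ENNReal) (hf : Measurable f) :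
    ∫⁻ x, f x = ∫⁻ t : ℝ, ∫⁻ x : Fin n → ℝ, f (Fin.cons t x) := by
  have hp := (volume_preserving_piFinSuccAbove (fun _ : Fin (n+1) => ℝ) 0).symm
  rw [← hp.lintegral_comp hf, Measure.volume_eq_prod, lintegral_prod]
  · simp only [pi_cons]
  · exact (hf.comp (MeasurableEquiv.measurable _)).aemeasurable

theorem meas_cons (n : ℕ) :
    Measurable (fun p : ℝ × (Fin n → ℝ) => (Fin.cons p.1 p.2 : Fin (n+1) → ℝ)) := by
  have h := (MeasurableEquiv.piFinSuccAbove (fun _ : Fin (n+1) => ℝ) 0).symm.measurable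
  convert h using 1
  funext p
  exact (pi_cons n p.1 p.2).symm

theorem cons_inf (n : ℕ) (s t : ℝ) (x y : Fin n → ℝ) :
    (Fin.cons s x : Fin (n+1) → ℝ) ⊓ Fin.cons t y = Fin.cons (s ⊓ t) (x ⊓ y) := by
  ext i
  refine Fin.cases ?_ (fun j => ?_) i <;> simp

theorem cons_sup (n : ℕ) (s t : ℝ) (x y : Fin n → ℝ) :
    (Fin.cons s x : Fin (n+1) → ℝ) ⊔ Fin.cons t y = Fin.cons (s ⊔ t) (x ⊔ y) := by
  ext i
  refine Fin.cases ?_ (fun j => ?_) i <;> simp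

theorem four_n (n : ℕ) : ∀ (f₁ f₂ f₃ f₄ : (Fin n → ℝ) → ENNReal)
    (_ : Measurable f₁) (_ : Measurable f₂) (_ : Measurable f₃) (_ : Measurable f₄)
    (_ : ∀ x y, f₁ x * f₂ y ≤ f₃ (x ⊓ y) * f₄ (x ⊔ y)),
    (∫⁻ x, f₁ x) * (∫⁻ x, f₂ x) ≤ (∫⁻ x, f₃ x) * ∫⁻ x, f₄ x := by
  induction n with
  | zero =>
    intro f₁ f₂ f₃ f₄ m₁ m₂ m₃ m₄ h
    have key : ∀ f : (Fin 0 → ℝ) → ENNReal, ∫⁻ x, f x = f 0 := by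
      intro f
      rw [lintegral_unique, Measure.volume_pi_eq_dirac 0]
      rw [measure_univ, mul_one]
      exact congrArg f (Subsingleton.elim _ _)
    simp only [key]
    simpa using h 0 0
  | succ n ih =>
    intro f₁ f₂ f₃ f₄ m₁ m₂ m₃ m₄ h
    have mm : ∀ f : (Fin (n+1) → ℝ) → ENNReal, Measurable f →
        Measurable (fun t : ℝ => ∫⁻ x : Fin n → ℝ, f (Fin.cons t x)) := fun f hf =>
      Measurable.lintegral_prod_right' (f := fun p : ℝ × (Fin n → ℝ) => f (Fin.cons p.1 p.2))
        (hf.comp (meas_cons n))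
    have ms : ∀ f : (Fin (n+1) → ℝ) → ENNReal, Measurable f → ∀ t : ℝ,
        Measurable (fun x : Fin n → ℝ => f (Fin.cons t x)) := fun f hf t =>
      (hf.comp (meas_cons n)).comp (measurable_const.prodMk measurable_id)
    rw [lint_succ n f₁ m₁, lint_succ n f₂ m₂, lint_succ n f₃ m₃, lint_succ n f₄ m₄]
    refine four_one _ _ _ _ (mm _ m₁) (mm _ m₂) (mm _ m₃) (mm _ m₄) fun s t => ?_
    refine ih _ _ _ _ (ms _ m₁ s) (ms _ m₂ t) (ms _ m₃ _) (ms _ m₄ _) fun x y => ?_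
    rw [← cons_inf, ← cons_sup]
    exact h _ _

theorem four_real (n : ℕ) (f₁ f₂ f₃ f₄ : (Fin n → ℝ) → ℝ)
    (m₁ : Measurable f₁) (m₂ : Measurable f₂) (m₃ : Measurable f₃) (m₄ : Measurable f₄)
    (p₁ : ∀ x, 0 ≤ f₁ x) (p₂ : ∀ x, 0 ≤ f₂ x) (p₃ : ∀ x, 0 ≤ f₃ x) (p₄ : ∀ x, 0 ≤ f₄ x)
    (i₁ : Integrable f₁) (i₂ : Integrable f₂) (i₃ : Integrable f₃) (i₄ : Integrable f₄)
    (h : ∀ x y, f₁ x * f₂ y ≤ f₃ (x ⊓ y) * f₄ (x ⊔ y)) :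
    (∫ x, f₁ x) * (∫ x, f₂ x) ≤ (∫ x, f₃ x) * ∫ x, f₄ x := by
  have := four_n n (fun x => ENNReal.ofReal (f₁ x)) (fun x => ENNReal.ofReal (f₂ x))
    (fun x => ENNReal.ofReal (f₃ x)) (fun x => ENNReal.ofReal (f₄ x))
    m₁.ennreal_ofReal m₂.ennreal_ofReal m₃.ennreal_ofReal m₄.ennreal_ofReal
    (fun x y => by
      rw [← ENNReal.ofReal_mul (p₁ x), ← ENNReal.ofReal_mul (p₃ _)]
      exact ENNReal.ofReal_le_ofReal (h x y))
  rw [← ofReal_integral_eq_lintegral_ofReal i₁ (.of_forall p₁),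
    ← ofReal_integral_eq_lintegral_ofReal i₂ (.of_forall p₂),
    ← ofReal_integral_eq_lintegral_ofReal i₃ (.of_forall p₃),
    ← ofReal_integral_eq_lintegral_ofReal i₄ (.of_forall p₄),
    ← ENNReal.ofReal_mul (integral_nonneg p₁), ← ENNReal.ofReal_mul (integral_nonneg p₃)] at this
  exact (ENNReal.ofReal_le_ofReal_iff
    (mul_nonneg (integral_nonneg p₃) (integral_nonneg p₄))).1 this

/-- Proposition 2 (Z-matching, multivariate U): with a log-supermodular prior density `g`
on ℝᵈ and a coordinatewise nondecreasing propensity `π`, the Bayes posterior `π g / c₁`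
stochastically dominates the posterior `(1 - π) g / c₀`. -/
theorem stmt3 (d : ℕ) (hd : 1 ≤ d)
    (g : (Fin d → ℝ) → ℝ) (hg_nn : ∀ u, 0 ≤ g u) (hg_meas : Measurable g)
    (hg_int : ∫ u, g u = 1)
    (hg_lsm : ∀ u u' : Fin d → ℝ, g u * g u' ≤ g (u ⊓ u') * g (u ⊔ u'))
    (π : (Fin d → ℝ) → ℝ) (hπ_meas : Measurable π) (hπ_mono : Monotone π)
    (hπ01 : ∀ u, 0 ≤ π u ∧ π u ≤ 1)
    (c₁ c₀ : ℝ) (hc₁ : c₁ = ∫ u, π u * g u)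
    (hc₁_pos : 0 < c₁) (hc₁_lt : c₁ < 1) (hc₀ : c₀ = 1 - c₁)
    (f₁ f₀ : (Fin d → ℝ) → ℝ)
    (hf₁ : ∀ u, f₁ u = π u * g u / c₁)
    (hf₀ : ∀ u, f₀ u = (1 - π u) * g u / c₀)
    (φ : (Fin d → ℝ) → ℝ) (hφ_meas : Measurable φ) (hφ_mono : Monotone φ)
    (hφ_bdd : ∃ C, ∀ u, |φ u| ≤ C) :
    ∫ u, φ u * f₀ u ≤ ∫ u, φ u * f₁ u := by
  obtain ⟨C, hC⟩ := hφ_bdd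
  have hg : Integrable g := by
    by_contra hn
    rw [integral_undef hn] at hg_int
    exact zero_ne_one hg_int
  have hπg : Integrable (fun u => π u * g u) :=
    hg.bdd_mul (c := 1) hπ_meas.aestronglyMeasurable
      (.of_forall fun u => by rw [Real.norm_eq_abs, abs_of_nonneg (hπ01 u).1]; exact (hπ01 u).2)
  have hφg : Integrable (fun u => φ u * g u) :=
    hg.bdd_mul (c := C) hφ_meas.aestronglyMeasurable (.of_forall fun u => hC u)
  have hφπg : Integrable (fun u => φ u * (π u * g u)) :=
    hπg.bdd_mul (c := C) hφ_meas.aestronglyMeasurable (.of_forall fun u => hC u)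
  have hp : ∀ u, 0 ≤ φ u + C := fun u => by linarith [neg_abs_le (φ u), hC u]
  have e1 : ∀ u, (φ u + C) * g u = φ u * g u + C * g u := fun u => by ring
  have e2 : ∀ u, (φ u + C) * (π u * g u) = φ u * (π u * g u) + C * (π u * g u) :=
    fun u => by ring
  have key := four_real d (fun u => (φ u + C) * g u) (fun u => π u * g u) g
    (fun u => (φ u + C) * (π u * g u)) (by fun_prop) (by fun_prop) hg_meas (by fun_prop)
    (fun u => mul_nonneg (hp u) (hg_nn u)) (fun u => mul_nonneg (hπ01 u).1 (hg_nn u)) hg_nn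
    (fun u => mul_nonneg (hp u) (mul_nonneg (hπ01 u).1 (hg_nn u)))
    (by simp_rw [e1]; exact hφg.add (hg.const_mul C)) hπg hg
    (by simp_rw [e2]; exact hφπg.add (hπg.const_mul C))
    (fun x y => by
      have a1 : φ x + C ≤ φ (x ⊔ y) + C := by linarith [hφ_mono (le_sup_left : x ≤ x ⊔ y)]
      have a2 : π y ≤ π (x ⊔ y) := hπ_mono le_sup_right
      calc (φ x + C) * g x * (π y * g y) = ((φ x + C) * π y) * (g x * g y) := by ring
        _ ≤ ((φ (x ⊔ y) + C) * π (x ⊔ y)) * (g (x ⊓ y) * g (x ⊔ y)) :=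
          mul_le_mul (mul_le_mul a1 a2 (hπ01 y).1 (hp _)) (hg_lsm x y)
            (mul_nonneg (hg_nn _) (hg_nn _)) (mul_nonneg (hp _) (hπ01 _).1)
        _ = _ := by ring)
  simp_rw [e1, e2] at key
  rw [integral_add hφg (hg.const_mul C), integral_add hφπg (hπg.const_mul C),
    integral_const_mul, integral_const_mul, hg_int, ← hc₁] at key
  have r1 : ∫ u, φ u * f₁ u = (∫ u, φ u * (π u * g u)) / c₁ := by
    rw [← integral_div]
    congr 1; ext u; rw [hf₁]; ring
  have r0 : ∫ u, φ u * f₀ u = ((∫ u, φ u * g u) - ∫ u, φ u * (π u * g u)) / c₀ := by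
    rw [← integral_sub hφg hφπg, ← integral_div]
    congr 1; ext u; rw [hf₀]; ring
  rw [r1, r0, div_le_div_iff₀ (by linarith) hc₁_pos, hc₀]
  nlinarith
end

section
/- (π-dominance, Proposition 5) Let d ≥ 1 and let h : ℝ × ℝᵈ → ℝ be strictly positive with log h twice continuously differentiable, satisfying ∂² log h / ∂u⁽ʲ⁾∂u⁽ᵏ⁾ (p, u) ≥ 0 for all j ≠ k and ∂² log h / ∂p ∂u⁽ʲ⁾ (p, u) ≤ 0 for all j, at every (p, u), and such that for each p ∈ ℝ the function u ↦ h(p, u) is Lebesgue-integrable with 0 < ∫ h(p, u) du < ∞. Then for all p', p ∈ ℝ with p' < p, the probability measure with density u ↦ h(p', u) / ∫ h(p', ·) stochastically dominates the probability measure with density u ↦ h(p, u) / ∫ h(p, ·): for every bounded Borel-measurable coordinatewise-nondecreasing φ : ℝᵈ → ℝ, the corresponding integrals are ordered. -/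
open MeasureTheory

lemma aux_mono {E : Type*} [NormedAddCommGroup E] [NormedSpace ℝ E] (F : E → ℝ)
    (hF : Differentiable ℝ F) (W : E) (hW : ∀ q, 0 ≤ fderiv ℝ F q W) (Q : E) :
    F Q ≤ F (Q + W) := by
  have hd : ∀ t : ℝ, HasDerivAt (fun t : ℝ => F (Q + t • W)) (fderiv ℝ F (Q + t • W) W) t := by
    intro t
    have h1 : HasDerivAt (fun t : ℝ => Q + t • W) W t := by
      simpa using ((hasDerivAt_id t).smul_const W).const_add Q
    exact (hF (Q + t • W)).hasFDerivAt.comp_hasDerivAt t h1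
  have hm : Monotone (fun t : ℝ => F (Q + t • W)) :=
    monotone_of_deriv_nonneg (fun t => (hd t).differentiableAt)
      (fun t => by rw [(hd t).deriv]; exact hW _)
  simpa using hm (zero_le_one (α := ℝ))

lemma aux_super {E : Type*} [NormedAddCommGroup E] [NormedSpace ℝ E] (L : E → ℝ)
    (hL : ContDiff ℝ 2 L) (V W : E)
    (hVW : ∀ q, 0 ≤ fderiv ℝ (fun r => fderiv ℝ L r V) q W) (Q : E) :
    L (Q + V) + L (Q + W) ≤ L Q + L (Q + V + W) := by
  have hLd : Differentiable ℝ L := hL.differentiable (by norm_num)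
  have hL1 : Differentiable ℝ (fderiv ℝ L) :=
    (hL.fderiv_right (m := 1) (by norm_num)).differentiable (by norm_num)
  have h1 := aux_mono (fun r => fderiv ℝ L r V) (hL1.clm_apply (differentiable_const V)) W hVW
  have hG : ∀ q, HasFDerivAt (fun q => L (q + W) - L q)
      (fderiv ℝ L (q + W) - fderiv ℝ L q) q := by
    intro q
    have h3 : HasFDerivAt (fun q => L (q + W)) (fderiv ℝ L (q + W)) q :=
      (hasFDerivAt_comp_add_right W).2 (hLd (q + W)).hasFDerivAt
    exact h3.sub (hLd q).hasFDerivAt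
  have h2 := aux_mono (fun q => L (q + W) - L q) (fun q => (hG q).differentiableAt) V
    (fun q => by
      rw [(hG q).fderiv]
      have := h1 q
      simpa using this) Q
  linarith

lemma aux_ennreal (a b c d : ENNReal) (hac : a ≤ c) (hbc : b ≤ c) (hab : a * b ≤ c * d) :
    a + b ≤ c + d := by
  by_cases hc : c = ⊤
  · simp [hc]
  by_cases hd : d = ⊤
  · simp [hd]
  lift c to NNReal using hc
  lift d to NNReal using hd
  lift a to NNReal using (ne_top_of_le_ne_top ENNReal.coe_ne_top hac)
  lift b to NNReal using (ne_top_of_le_ne_top ENNReal.coe_ne_top hbc)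
  norm_cast at *
  rcases eq_or_lt_of_le (bot_le : (0 : NNReal) ≤ c) with h0 | h0
  · subst h0
    simp_all
  · have h1 : (a:ℝ) ≤ c := by exact_mod_cast hac
    have h2 : (b:ℝ) ≤ c := by exact_mod_cast hbc
    have h3 : (a:ℝ) * b ≤ c * d := by exact_mod_cast hab
    have h4 : (0:ℝ) < c := by exact_mod_cast h0
    have : (a:ℝ) + b ≤ c + d := by
      by_contra! hh
      nlinarith [mul_nonneg (sub_nonneg.2 h1) (sub_nonneg.2 h2), mul_lt_mul_of_pos_left hh h4]
    exact_mod_cast this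

lemma aux_four_one (f1 f2 f3 f4 : ℝ → ENNReal) (m1 : Measurable f1) (m2 : Measurable f2)
    (m3 : Measurable f3) (m4 : Measurable f4)
    (hf : ∀ x y, f1 x * f2 y ≤ f3 (x ⊔ y) * f4 (x ⊓ y)) :
    (∫⁻ x, f1 x) * (∫⁻ x, f2 x) ≤ (∫⁻ x, f3 x) * (∫⁻ x, f4 x) := by
  have key : ∀ x y, y ≤ x → f1 x * f2 y + f1 y * f2 x ≤ f3 x * f4 y + f3 y * f4 x := by
    intro x y hxy
    apply aux_ennreal
    · simpa [hxy] using hf x y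
    · simpa [hxy] using hf y x
    · have h1 := hf x x
      have h2 := hf y y
      simp only [sup_idem, inf_idem] at h1 h2
      calc f1 x * f2 y * (f1 y * f2 x) = (f1 x * f2 x) * (f1 y * f2 y) := by ring
        _ ≤ (f3 x * f4 x) * (f3 y * f4 y) := mul_le_mul' h1 h2
        _ = _ := by ring
  have key2 : ∀ x y, f1 x * f2 y + f1 y * f2 x ≤ f3 x * f4 y + f3 y * f4 x := by
    intro x y
    rcases le_total y x with h | h
    · exact key x y h
    · have := key y x h
      rwa [add_comm, add_comm (f3 x * f4 y)]
  have e : ∀ f g : ℝ → ENNReal, Measurable f → Measurable g →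
      ∫⁻ x, ∫⁻ y, (f x * g y + f y * g x) = 2 * ((∫⁻ x, f x) * (∫⁻ x, g x)) := by
    intro f g hf hg
    have : ∀ x, ∫⁻ y, (f x * g y + f y * g x) = f x * (∫⁻ y, g y) + (∫⁻ y, f y) * g x := by
      intro x
      rw [lintegral_add_left (hg.const_mul _), lintegral_const_mul _ hg, lintegral_mul_const _ hf]
    simp_rw [this]
    rw [lintegral_add_left (hf.mul_const _), lintegral_mul_const _ hf, lintegral_const_mul _ hg,
      two_mul]
  have h := lintegral_mono (μ := volume) (fun x => lintegral_mono (μ := volume) (key2 x))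
  rw [e f1 f2 m1 m2, e f3 f4 m3 m4] at h
  exact (ENNReal.mul_le_mul_iff_right (by norm_num) (by norm_num)).1 h

lemma aux_lint (n : ℕ) (f : (Fin (n+1) → ℝ) → ENNReal) (hf : Measurable f) :
    ∫⁻ x, f x = ∫⁻ y : Fin n → ℝ, ∫⁻ t : ℝ, f (Fin.cons t y) := by
  have hp := (volume_preserving_piFinSuccAbove (fun _ : Fin (n+1) => ℝ) 0).symm
  rw [← hp.lintegral_comp hf, Measure.volume_eq_prod, lintegral_prod_symm']
  · simp [MeasurableEquiv.piFinSuccAbove]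
    rfl
  · exact hf.comp (MeasurableEquiv.measurable _)

lemma aux_cons_meas (n : ℕ) :
    Measurable (fun z : (Fin n → ℝ) × ℝ => (Fin.cons z.2 z.1 : Fin (n+1) → ℝ)) := by
  rw [measurable_pi_iff]
  intro i
  refine Fin.cases ?_ (fun j => ?_) i
  · simpa using measurable_snd
  · simp only [Fin.cons_succ]; fun_prop

lemma aux_four (n : ℕ) : ∀ (f1 f2 f3 f4 : (Fin n → ℝ) → ENNReal) (_ : Measurable f1)
    (_ : Measurable f2) (_ : Measurable f3) (_ : Measurable f4)
    (_ : ∀ x y, f1 x * f2 y ≤ f3 (x ⊔ y) * f4 (x ⊓ y)),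
    (∫⁻ x, f1 x) * (∫⁻ x, f2 x) ≤ (∫⁻ x, f3 x) * (∫⁻ x, f4 x) := by
  induction n with
  | zero =>
    intro f1 f2 f3 f4 m1 m2 m3 m4 hf
    have := hf default default
    simp only [sup_idem, inf_idem] at this
    have e : ∀ f : (Fin 0 → ℝ) → ENNReal, ∫⁻ x, f x = f default := by
      intro f
      simp [lintegral_unique, volume_pi]
      exact congrArg f (Subsingleton.elim _ _)
    simp only [e]
    exact this
  | succ n ih =>
    intro f1 f2 f3 f4 m1 m2 m3 m4 hf
    have mc : ∀ y : Fin n → ℝ, Measurable (fun t : ℝ => (Fin.cons t y : Fin (n+1) → ℝ)) :=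
      fun y => (aux_cons_meas n).comp (measurable_const.prodMk measurable_id)
    have mi : ∀ f : (Fin (n+1) → ℝ) → ENNReal, Measurable f →
        Measurable (fun y : Fin n → ℝ => ∫⁻ t : ℝ, f (Fin.cons t y)) := fun f hf =>
      (hf.comp (aux_cons_meas n)).lintegral_prod_right'
    rw [aux_lint n f1 m1, aux_lint n f2 m2, aux_lint n f3 m3, aux_lint n f4 m4]
    apply ih _ _ _ _ (mi _ m1) (mi _ m2) (mi _ m3) (mi _ m4)
    intro x y
    apply aux_four_one _ _ _ _ (m1.comp (mc _)) (m2.comp (mc _)) (m3.comp (mc _)) (m4.comp (mc _))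
    intro s t
    have := hf (Fin.cons s x) (Fin.cons t y)
    have e1 : (Fin.cons s x ⊔ Fin.cons t y : Fin (n+1) → ℝ) = Fin.cons (s ⊔ t) (x ⊔ y) := by
      ext i; refine Fin.cases ?_ (fun j => ?_) i <;> simp
    have e2 : (Fin.cons s x ⊓ Fin.cons t y : Fin (n+1) → ℝ) = Fin.cons (s ⊓ t) (x ⊓ y) := by
      ext i; refine Fin.cases ?_ (fun j => ?_) i <;> simp
    rwa [e1, e2] at this

lemma aux_dir (d : ℕ) (L : ℝ × (Fin d → ℝ) → ℝ)
    (hL : ContDiff ℝ 2 L)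
    (huu : ∀ j k : Fin d, j ≠ k → ∀ p : ℝ × (Fin d → ℝ),
      0 ≤ fderiv ℝ (fun q => fderiv ℝ L q ((0 : ℝ), Pi.single j 1)) p ((0 : ℝ), Pi.single k 1))
    (hpu : ∀ j : Fin d, ∀ p : ℝ × (Fin d → ℝ),
      fderiv ℝ (fun q => fderiv ℝ L q ((0 : ℝ), Pi.single j 1)) p
        ((1 : ℝ), (0 : Fin d → ℝ)) ≤ 0)
    (p' p : ℝ) (hp : p' < p) (x y : Fin d → ℝ) :
    L (p, x) + L (p', y) ≤ L (p', x ⊔ y) + L (p, x ⊓ y) := by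
  set a : Fin d → ℝ := x - x ⊓ y with ha
  set b : Fin d → ℝ := y - x ⊓ y with hb
  have ha0 : ∀ j, 0 ≤ a j := fun j => by simp [ha]
  have hb0 : ∀ j, 0 ≤ b j := fun j => by simp [hb]
  have hab : ∀ j, a j * b j = 0 := fun j => by
    rcases le_total (x j) (y j) with h | h <;> simp [ha, hb, h]
  have hL1 : Differentiable ℝ (fderiv ℝ L) :=
    (hL.fderiv_right (m := 1) (by norm_num)).differentiable (by norm_num)
  have ev : ∀ c : Fin d → ℝ, ((0:ℝ), c) = ∑ j, c j • ((0:ℝ), (Pi.single j 1 : Fin d → ℝ)) := by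
    intro c
    ext i
    · simp [Prod.fst_sum]
    · simp [Prod.snd_sum, Finset.sum_apply, Pi.single_apply]
  have hD : ∀ (v w q : ℝ × (Fin d → ℝ)), fderiv ℝ (fun r => fderiv ℝ L r v) q w
      = fderiv ℝ (fderiv ℝ L) q w v := by
    intro v w q
    rw [fderiv_clm_apply (hL1 q) (differentiableAt_const v)]
    simp
  simp only [hD] at huu hpu
  have := aux_super L hL (0, a) (p' - p, b) (fun q => by
    rw [hD]
    have e2 : ((p' - p, b) : ℝ × (Fin d → ℝ)) = (p' - p) • ((1:ℝ), (0 : Fin d → ℝ)) + (0, b) := by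
      simp
    rw [e2, ev a, map_sum]
    refine Finset.sum_nonneg fun j _ => ?_
    rw [map_smul, smul_eq_mul]
    rw [map_add, map_smul, ev b, map_sum]
    simp only [add_apply, smul_apply, sum_apply, map_smul, smul_eq_mul, mul_add, Finset.mul_sum]
    refine add_nonneg (mul_nonneg (ha0 j) (mul_nonneg_of_nonpos_of_nonpos (by linarith) (hpu j q)))
      (Finset.sum_nonneg fun k _ => ?_)
    rw [← mul_assoc]
    by_cases hjk : j = k
    · subst hjk; rw [hab]; simp
    · exact mul_nonneg (mul_nonneg (ha0 j) (hb0 k)) (huu j k hjk q)) (p, x ⊓ y)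
  have e1 : ((p, x ⊓ y) : ℝ × (Fin d → ℝ)) + (0, a) = (p, x) := by simp [ha]
  have e2 : ((p, x ⊓ y) : ℝ × (Fin d → ℝ)) + (p' - p, b) = (p', y) := by simp [hb]
  have e3 : ((p, x) : ℝ × (Fin d → ℝ)) + (p' - p, b) = (p', x ⊔ y) := by
    ext i
    · simp
    · have := inf_add_sup (x i) (y i)
      simp only [hb, Prod.mk_add_mk, Pi.add_apply, Pi.sub_apply, Pi.inf_apply, Pi.sup_apply]
      linarith
  rw [e1, e2, e3] at this
  linarith

/-- Proposition 5 (π-dominance): if `log h` on ℝ × ℝᵈ is C² with nonnegative within-`u`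
cross partials and nonpositive across-`p`-`u` cross partials, then for `p' < p` the
normalized density `h (p', ·)` stochastically dominates `h (p, ·)`. -/
theorem stmt16 (d : ℕ) (hd : 1 ≤ d)
    (h : ℝ × (Fin d → ℝ) → ℝ)
    (hpos : ∀ p, 0 < h p)
    (hsmooth : ContDiff ℝ 2 (fun p => Real.log (h p)))
    (hcross_uu : ∀ j k : Fin d, j ≠ k → ∀ p : ℝ × (Fin d → ℝ),
      0 ≤ fderiv ℝ (fun q => fderiv ℝ (fun r => Real.log (h r)) q
            ((0 : ℝ), Pi.single j 1)) p ((0 : ℝ), Pi.single k 1))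
    (hcross_pu : ∀ j : Fin d, ∀ p : ℝ × (Fin d → ℝ),
      fderiv ℝ (fun q => fderiv ℝ (fun r => Real.log (h r)) q
            ((0 : ℝ), Pi.single j 1)) p ((1 : ℝ), (0 : Fin d → ℝ)) ≤ 0)
    (hint : ∀ p : ℝ, Integrable (fun u => h (p, u)))
    (hint_pos : ∀ p : ℝ, 0 < ∫ u, h (p, u))
    (p' p : ℝ) (hp : p' < p)
    (φ : (Fin d → ℝ) → ℝ) (hφ_meas : Measurable φ) (hφ_mono : Monotone φ)
    (hφ_bdd : ∃ C, ∀ u, |φ u| ≤ C) :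
    ∫ u, φ u * (h (p, u) / ∫ v, h (p, v)) ≤ ∫ u, φ u * (h (p', u) / ∫ v, h (p', v)) := by
  obtain ⟨C, hC⟩ := hφ_bdd
  have hcont : Continuous h := by
    have : h = fun q => Real.exp (Real.log (h q)) := by
      ext q; rw [Real.exp_log (hpos q)]
    rw [this]
    exact Real.continuous_exp.comp hsmooth.continuous
  set g : ℝ → (Fin d → ℝ) → ℝ := fun s u => h (s, u) / ∫ v, h (s, v) with hg
  have gpos : ∀ s u, 0 < g s u := fun s u => div_pos (hpos _) (hint_pos s)
  have gint : ∀ s, Integrable (g s) := fun s => (hint s).div_const _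
  have gmeas : ∀ s, Measurable (g s) := fun s =>
    ((hcont.comp (by fun_prop : Continuous fun u => (s, u))).div_const _).measurable
  have gone : ∀ s, ∫ u, g s u = 1 := fun s => by
    simp only [hg]
    rw [integral_div, div_self (hint_pos s).ne']
  have gsuper : ∀ x y, g p x * g p' y ≤ g p' (x ⊔ y) * g p (x ⊓ y) := by
    intro x y
    have hl := aux_dir d _ hsmooth hcross_uu hcross_pu p' p hp x y
    rw [← Real.log_mul (hpos _).ne' (hpos _).ne', ← Real.log_mul (hpos _).ne' (hpos _).ne',
      Real.log_le_log_iff (mul_pos (hpos _) (hpos _)) (mul_pos (hpos _) (hpos _))] at hl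
    simp only [hg]
    rw [div_mul_div_comm, div_mul_div_comm, mul_comm (∫ v, h (p', v))]
    exact div_le_div_of_nonneg_right hl (mul_pos (hint_pos _) (hint_pos _)).le
  have ψ0 : ∀ u, 0 ≤ φ u + C := fun u => by have := (abs_le.1 (hC u)).1; linarith
  have ψm : Measurable (fun u => φ u + C) := hφ_meas.add_const C
  have φint : ∀ s, Integrable (fun u => φ u * g s u) := fun s =>
    (gint s).bdd_mul (c := C) hφ_meas.aestronglyMeasurable (Filter.Eventually.of_forall hC)
  have ψint : ∀ s, Integrable (fun u => (φ u + C) * g s u) := fun s => by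
    simp_rw [add_mul]
    exact (φint s).add ((gint s).const_mul C)
  have ψeq : ∀ s, ∫ u, (φ u + C) * g s u = (∫ u, φ u * g s u) + C := fun s => by
    simp_rw [add_mul]
    rw [integral_add (φint s) ((gint s).const_mul C), integral_const_mul, gone, mul_one]
  have four := aux_four d (fun u => ENNReal.ofReal ((φ u + C) * g p u))
    (fun u => ENNReal.ofReal (g p' u)) (fun u => ENNReal.ofReal ((φ u + C) * g p' u))
    (fun u => ENNReal.ofReal (g p u)) (ψm.mul (gmeas p)).ennreal_ofReal (gmeas p').ennreal_ofReal
    (ψm.mul (gmeas p')).ennreal_ofReal (gmeas p).ennreal_ofReal (by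
      intro x y
      rw [← ENNReal.ofReal_mul (mul_nonneg (ψ0 _) (gpos _ _).le),
        ← ENNReal.ofReal_mul (mul_nonneg (ψ0 _) (gpos _ _).le), mul_assoc, mul_assoc]
      apply ENNReal.ofReal_le_ofReal
      have := hφ_mono (le_sup_left : x ≤ x ⊔ y)
      exact mul_le_mul (by linarith) (gsuper x y) (mul_pos (gpos _ _) (gpos _ _)).le (ψ0 _))
  have hn : ∀ s, 0 ≤ᵐ[volume] fun u => (φ u + C) * g s u := fun s =>
    Filter.Eventually.of_forall fun u => mul_nonneg (ψ0 u) (gpos s u).le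
  have hn' : ∀ s, 0 ≤ᵐ[volume] g s := fun s =>
    Filter.Eventually.of_forall fun u => (gpos s u).le
  rw [← ofReal_integral_eq_lintegral_ofReal (ψint p) (hn p),
    ← ofReal_integral_eq_lintegral_ofReal (ψint p') (hn p'),
    ← ofReal_integral_eq_lintegral_ofReal (gint p) (hn' p),
    ← ofReal_integral_eq_lintegral_ofReal (gint p') (hn' p'), gone, gone, ENNReal.ofReal_one,
    mul_one, mul_one, ENNReal.ofReal_le_ofReal_iff (integral_nonneg_of_ae (hn p')), ψeq, ψeq] at four
  exact le_of_add_le_add_right four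
end
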